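/- Let F be an algebraically closed field and let D₁ be a division ring equipped with an F-algebra structure. Suppose there exist a subring S ⊆ D₁ containing the image of F and an element π ∈ S with π ≠ 0 and π not a unit of S, such that: (i) πS = Sπ (so πS is a two-sided ideal of S); (ii) every nonzero element of D₁ can be written as u·πⁿ for some unit u of S and some integer n (negative powers of π taken in D₁); and (iii) the quotient ring S/πS is commutative. Then for every division ring D₂ equipped with an F-algebra structure, the ring D₁ ⊗_F D₂ has no zero divisors. -/

import Mathlib

open scoped TensorProduct

section helpers

open Classical in
/-- Coefficients of a tensor with respect to a basis of the right factor. -/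
theorem trt_transfer {F R L K D κ : Type*} [Field F] [Ring R] [Ring L] [Ring K] [Ring D]
    [Algebra F R] [Algebra F L] [Algebra F K] [Algebra F D] (b : Module.Basis κ F D)
    (j : R →ₐ[F] L) (hj : Function.Injective j) (f : R →ₐ[F] K) (x : L ⊗[F] D) (s : κ → R)
    (hs : ∀ i, j (s i) = TensorProduct.equivFinsuppOfBasisRight b x i) (i₀ : κ)
    (hi₀ : f (s i₀) ≠ 0) :
    ∃ y : R ⊗[F] D, Algebra.TensorProduct.map j (AlgHom.id F D) y = x ∧
      Algebra.TensorProduct.map f (AlgHom.id F D) y ≠ 0 := by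
  set c := TensorProduct.equivFinsuppOfBasisRight b x with hc
  have hsup : ∀ i, i ∉ c.support → s i = 0 := by
    intro i hi
    apply hj
    rw [hs, map_zero]
    simpa using hi
  refine ⟨∑ i ∈ c.support, s i ⊗ₜ b i, ?_, ?_⟩
  · have hx : x = (TensorProduct.equivFinsuppOfBasisRight b).symm c := by simp [hc]
    conv_rhs => rw [hx, TensorProduct.equivFinsuppOfBasisRight_symm_apply]
    simp [hs, Finsupp.sum]
  · intro h
    have h2 := congrArg (fun t => TensorProduct.equivFinsuppOfBasisRight b t i₀) h
    have hmem : i₀ ∈ c.support := by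
      by_contra hn
      exact hi₀ (by rw [hsup _ hn, map_zero])
    simp only [map_sum, Algebra.TensorProduct.map_tmul, AlgHom.id_apply, map_zero,
      Finsupp.coe_zero, Pi.zero_apply, Finsupp.finsetSum_apply,
      TensorProduct.equivFinsuppOfBasisRight_apply_tmul_apply, Module.Basis.repr_self] at h2
    rw [Finset.sum_eq_single i₀] at h2
    · simp at h2
      exact hi₀ h2
    · intro i _ hne
      simp [hne]
    · intro hn; exact absurd hmem hn

theorem trt_map_injective {F R L D : Type*} [Field F] [Ring R] [Ring L] [Ring D]
    [Algebra F R] [Algebra F L] [Algebra F D]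
    (j : R →ₐ[F] L) (hj : Function.Injective j) :
    Function.Injective (Algebra.TensorProduct.map j (AlgHom.id F D)) :=
  Module.Flat.rTensor_preserves_injective_linearMap (M := D) j.toLinearMap hj

theorem trt_exists_point {F A : Type*} [Field F] [IsAlgClosed F] [CommRing A] [Nontrivial A]
    [Algebra F A] [Algebra.FiniteType F A] : Nonempty (A →ₐ[F] F) := by
  obtain ⟨m, hm⟩ := Ideal.exists_maximal A
  letI : Field (A ⧸ m) := Ideal.Quotient.field m
  have : Module.Finite F (A ⧸ m) := finite_of_finite_type_of_isJacobsonRing F (A ⧸ m)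
  have hb : Function.Bijective (algebraMap F (A ⧸ m)) :=
    IsAlgClosed.algebraMap_bijective_of_isIntegral
  exact ⟨((AlgEquiv.ofBijective (Algebra.ofId F (A ⧸ m)) hb).symm : (A ⧸ m) →ₐ[F] F).comp
    (Ideal.Quotient.mkₐ F m)⟩

open Classical in
theorem trt_field {F K D : Type*} [Field F] [IsAlgClosed F] [Field K] [Algebra F K]
    [DivisionRing D] [Algebra F D] (x y : K ⊗[F] D) (hx : x ≠ 0) (hy : y ≠ 0) :
    x * y ≠ 0 := by
  intro hxy
  obtain ⟨⟨κ, b⟩⟩ := Module.Free.exists_basis (R := F) (M := D)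
  let e := TensorProduct.equivFinsuppOfBasisRight (M := K) b
  obtain ⟨i, hi⟩ : ∃ i, e x i ≠ 0 := by
    by_contra! h
    exact hx (e.map_eq_zero_iff.1 (Finsupp.ext h))
  obtain ⟨k, hk⟩ : ∃ k, e y k ≠ 0 := by
    by_contra! h
    exact hy (e.map_eq_zero_iff.1 (Finsupp.ext h))
  let T : Set K := Set.range (e x) ∪ Set.range (e y) ∪ {(e x i)⁻¹, (e y k)⁻¹}
  have hT : T.Finite := by
    refine ((Finsupp.finite_range _).union (Finsupp.finite_range _)).union ?_
    simp
  let A := Algebra.adjoin F T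
  haveI : Algebra.FiniteType F A := Algebra.FiniteType.adjoin_of_finite hT
  obtain ⟨φ⟩ := trt_exists_point (F := F) (A := A)
  have hTA : ∀ t ∈ T, t ∈ A := fun t ht => Algebra.subset_adjoin ht
  have hxA : ∀ l, e x l ∈ A := fun l => hTA _ (Or.inl (Or.inl ⟨l, rfl⟩))
  have hyA : ∀ l, e y l ∈ A := fun l => hTA _ (Or.inl (Or.inr ⟨l, rfl⟩))
  have key : ∀ (a : K) (ha : a ∈ A), a ≠ 0 → a⁻¹ ∈ A → φ ⟨a, ha⟩ ≠ 0 := by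
    intro a ha h0 hinv h
    have h1 : (⟨a, ha⟩ : A) * ⟨a⁻¹, hinv⟩ = 1 := Subtype.ext (mul_inv_cancel₀ h0)
    have h2 := congrArg φ h1
    rw [map_mul, h, zero_mul, map_one] at h2
    exact zero_ne_one h2
  have hAinj : Function.Injective A.val := Subtype.val_injective
  obtain ⟨x', hx', hx0⟩ := trt_transfer b A.val hAinj φ x (fun l => ⟨e x l, hxA l⟩)
    (fun l => rfl) i (key _ _ hi (hTA _ (Or.inr (by simp))))
  obtain ⟨y', hy', hy0⟩ := trt_transfer b A.val hAinj φ y (fun l => ⟨e y l, hyA l⟩)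
    (fun l => rfl) k (key _ _ hk (hTA _ (Or.inr (by simp))))
  have h0 : x' * y' = 0 := by
    apply trt_map_injective (D := D) A.val hAinj
    rw [map_mul, hx', hy', hxy, map_zero]
  have h1 := congrArg (fun t => Algebra.TensorProduct.lid F D
    (Algebra.TensorProduct.map φ (AlgHom.id F D) t)) h0
  simp only [map_mul, map_zero, mul_eq_zero, EmbeddingLike.map_eq_zero_iff] at h1
  exact h1.elim hx0 hy0

theorem trt_ring {F K D : Type*} [Field F] [IsAlgClosed F] [Ring K] [Nontrivial K] [Algebra F K]
    (hc : ∀ a b : K, a * b = b * a) (hinv : ∀ a : K, a ≠ 0 → ∃ b, a * b = 1)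
    [DivisionRing D] [Algebra F D] (x y : K ⊗[F] D) (hx : x ≠ 0) (hy : y ≠ 0) :
    x * y ≠ 0 := by
  letI cr : CommRing K := { (inferInstance : Ring K) with mul_comm := hc }
  have hf : IsField K :=
    { exists_pair_ne := exists_pair_ne K, mul_comm := hc, mul_inv_cancel := fun {a} h => hinv a h }
  letI : Field K := hf.toField
  exact trt_field (F := F) (K := K) x y hx hy

open Classical in
theorem trt_scale {F D₁ D K : Type*} [Field F] [DivisionRing D₁] [Algebra F D₁] [Ring D]
    [Algebra F D] [Ring K] [Nontrivial K] [Algebra F K] (S : Subalgebra F D₁) (π : D₁)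
    (hπS : π ∈ S) (hπ0 : π ≠ 0)
    (hval : ∀ d : D₁, d ≠ 0 → ∃ u : Sˣ, ∃ n : ℤ, d = ((u : S) : D₁) * π ^ n)
    (f : S →ₐ[F] K) (x : D₁ ⊗[F] D) (hx : x ≠ 0) :
    ∃ (m : ℤ) (y : S ⊗[F] D), Algebra.TensorProduct.map S.val (AlgHom.id F D) y
        = x * ((π ^ (-m)) ⊗ₜ 1) ∧
      Algebra.TensorProduct.map f (AlgHom.id F D) y ≠ 0 := by
  obtain ⟨⟨κ, b⟩⟩ := Module.Free.exists_basis (R := F) (M := D)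
  let e := TensorProduct.equivFinsuppOfBasisRight (M := D₁) b
  have hne : (e x).support.Nonempty := by
    rw [Finsupp.support_nonempty_iff]
    exact fun h => hx (e.map_eq_zero_iff.1 h)
  choose! u n hun using hval
  obtain ⟨i₀, hi₀, hmin⟩ := Finset.exists_min_image (e x).support (fun i => n (e x i)) hne
  have hcoef : ∀ (z : D₁ ⊗[F] D) (d : D₁) i, e (z * (d ⊗ₜ 1)) i = e z i * d := by
    intro z d i
    induction z with
    | zero => simp
    | tmul p q => simp [e, TensorProduct.equivFinsuppOfBasisRight_apply_tmul_apply]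
    | add p q hp hq => simp only [add_mul, map_add, Finsupp.add_apply, hp, hq]
  set m := n (e x i₀) with hm
  have hform : ∀ i, e x i ≠ 0 →
      e x i * π ^ (-m) = ((u (e x i) : S) : D₁) * π ^ (n (e x i) - m) := by
    intro i hi
    conv_lhs => rw [hun _ hi]
    rw [mul_assoc, ← zpow_add₀ hπ0, sub_eq_add_neg]
  have hmemS : ∀ i, e x i * π ^ (-m) ∈ S := by
    intro i
    by_cases hi : e x i = 0
    · rw [hi, zero_mul]; exact S.zero_mem
    · rw [hform i hi]
      refine S.mul_mem (u (e x i) : S).2 ?_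
      have h := hmin i (by simpa using hi)
      obtain ⟨k, hk⟩ := Int.eq_ofNat_of_zero_le (sub_nonneg.2 h)
      rw [hk, zpow_natCast]
      exact S.pow_mem hπS k
  refine ⟨m, trt_transfer b S.val Subtype.val_injective f _
    (fun i => ⟨e x i * π ^ (-m), hmemS i⟩) (fun i => (hcoef x _ i).symm) i₀ ?_⟩
  have h0 : (⟨e x i₀ * π ^ (-m), hmemS i₀⟩ : S) = u (e x i₀) := by
    apply Subtype.ext
    have := hform i₀ (by simpa using hi₀)
    rw [← hm, sub_self, zpow_zero, mul_one] at this
    exact this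
  rw [h0]
  exact ((u (e x i₀)).isUnit.map f).ne_zero

end helpers

/-- Let `F` be an algebraically closed field and `D₁` a division ring which is an `F`-algebra.
Suppose `S` is a subring of `D₁` containing the image of `F` (i.e. an `F`-subalgebra) and
`π ∈ S` is a nonzero non-unit of `S` such that `πS = Sπ`, every nonzero element of `D₁` is of
the form `u·πⁿ` with `u` a unit of `S` and `n ∈ ℤ`, and the quotient `S/πS` is commutative
(every additive commutator `ab - ba` of elements of `S` lies in `πS`).  Then for any division
ring `D₂` which is an `F`-algebra, the ring `D₁ ⊗[F] D₂` has no zero divisors. -/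
theorem totally_ramified_tensor_no_zero_divisors
    (F D₁ : Type*) [Field F] [IsAlgClosed F] [DivisionRing D₁] [Algebra F D₁]
    (S : Subalgebra F D₁) (π : D₁) (hπS : π ∈ S) (hπ0 : π ≠ 0)
    (hπunit : ¬ IsUnit (⟨π, hπS⟩ : S))
    (htwosided : {x : D₁ | ∃ s ∈ S, x = π * s} = {x : D₁ | ∃ s ∈ S, x = s * π})
    (hval : ∀ d : D₁, d ≠ 0 → ∃ u : Sˣ, ∃ n : ℤ, d = ((u : S) : D₁) * π ^ n)
    (hcomm : ∀ a b : S, ∃ s ∈ S, (a : D₁) * b - (b : D₁) * a = π * s)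
    (D₂ : Type*) [DivisionRing D₂] [Algebra F D₂] :
    ∀ α₁ α₂ : D₁ ⊗[F] D₂, α₁ ≠ 0 → α₂ ≠ 0 → α₁ * α₂ ≠ 0 := by
  intro α₁ α₂ h₁ h₂ h12
  let I : Ideal S :=
    { carrier := {x : S | ∃ s ∈ S, (x : D₁) = s * π}
      add_mem' := by
        rintro a b ⟨s, hs, h⟩ ⟨t, ht, h'⟩
        exact ⟨s + t, S.add_mem hs ht, by push_cast; rw [h, h', add_mul]⟩
      zero_mem' := ⟨0, S.zero_mem, by simp⟩
      smul_mem' := by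
        rintro c a ⟨s, hs, h⟩
        exact ⟨c * s, S.mul_mem c.2 hs, by simp [h, mul_assoc]⟩ }
  have hI : ∀ x : S, x ∈ I ↔ ∃ s ∈ S, (x : D₁) = s * π := fun x => Iff.rfl
  have hI' : ∀ x : S, x ∈ I ↔ ∃ s ∈ S, (x : D₁) = π * s := fun x =>
    (Set.ext_iff.1 htwosided (x : D₁)).symm
  haveI : I.IsTwoSided := ⟨by
    intro a c ha
    rw [hI'] at ha ⊢
    obtain ⟨s, hs, h⟩ := ha
    exact ⟨s * c, S.mul_mem hs c.2, by push_cast; rw [h, mul_assoc]⟩⟩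
  have hinvS : π⁻¹ ∉ S := by
    intro h
    apply hπunit
    exact ⟨⟨⟨π, hπS⟩, ⟨π⁻¹, h⟩, Subtype.ext (mul_inv_cancel₀ hπ0),
      Subtype.ext (inv_mul_cancel₀ hπ0)⟩, rfl⟩
  have h1I : (1 : S) ∉ I := by
    rintro ⟨s, hs, h⟩
    apply hinvS
    have : s = π⁻¹ := eq_inv_of_mul_eq_one_left h.symm
    exact this ▸ hs
  haveI : Nontrivial (S ⧸ I) :=
    ⟨1, 0, fun h => h1I (Ideal.Quotient.eq_zero_iff_mem.1 h)⟩
  have hc : ∀ a b : S ⧸ I, a * b = b * a := by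
    intro a b
    obtain ⟨a, rfl⟩ := Ideal.Quotient.mk_surjective a
    obtain ⟨b, rfl⟩ := Ideal.Quotient.mk_surjective b
    rw [← map_mul, ← map_mul, Ideal.Quotient.eq, hI']
    exact hcomm a b
  have hinv : ∀ a : S ⧸ I, a ≠ 0 → ∃ b, a * b = 1 := by
    intro a ha
    obtain ⟨a, rfl⟩ := Ideal.Quotient.mk_surjective a
    rw [Ne, Ideal.Quotient.eq_zero_iff_mem] at ha
    have ha0 : (a : D₁) ≠ 0 := by
      intro h
      exact ha ⟨0, S.zero_mem, by simp [h]⟩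
    obtain ⟨u, n, hun⟩ := hval a ha0
    have hπn : π ^ n ∈ S := by
      have h1 : (((u⁻¹ : Sˣ) : S) : D₁) * ((u : S) : D₁) = 1 :=
        congrArg Subtype.val (Units.inv_mul u)
      have : π ^ n = (((u⁻¹ : Sˣ) : S) : D₁) * a := by
        rw [hun, ← mul_assoc, h1, one_mul]
      rw [this]
      exact S.mul_mem (Subtype.property _) a.2
    rcases lt_trichotomy n 0 with hn | hn | hn
    · exfalso
      apply hinvS
      obtain ⟨k, hk⟩ := Int.eq_ofNat_of_zero_le (show 0 ≤ -n - 1 by omega)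
      have : π⁻¹ = π ^ n * π ^ k := by
        rw [← zpow_natCast, ← zpow_add₀ hπ0, ← zpow_neg_one]
        congr 1
        omega
      rw [this]
      exact S.mul_mem hπn (S.pow_mem hπS k)
    · refine ⟨Ideal.Quotient.mk I ((u⁻¹ : Sˣ) : S), ?_⟩
      have : a = u := Subtype.ext (by rw [hun, hn, zpow_zero, mul_one])
      rw [← map_mul, this, Units.mul_inv, map_one]
    · exfalso
      apply ha
      obtain ⟨k, hk⟩ := Int.eq_ofNat_of_zero_le (show 0 ≤ n - 1 by omega)
      refine ⟨(u : S) * π ^ k, S.mul_mem (u : S).2 (S.pow_mem hπS k), ?_⟩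
      have hn' : n = ((k + 1 : ℕ) : ℤ) := by
        push_cast
        omega
      rw [hun, hn', zpow_natCast, pow_succ, mul_assoc]
  let f : S →ₐ[F] (S ⧸ I) := Ideal.Quotient.mkₐ F I
  obtain ⟨m, y₁, hy₁, hn₁⟩ := trt_scale S π hπS hπ0 hval f α₁ h₁
  have hcancel : ((π ^ (-m)) ⊗ₜ 1 : D₁ ⊗[F] D₂) * ((π ^ m) ⊗ₜ 1) = 1 := by
    rw [Algebra.TensorProduct.tmul_mul_tmul, ← zpow_add₀ hπ0]
    simp [Algebra.TensorProduct.one_def]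
  have h₂' : ((π ^ m) ⊗ₜ 1 : D₁ ⊗[F] D₂) * α₂ ≠ 0 := by
    intro h
    apply h₂
    rw [← one_mul α₂, ← hcancel, mul_assoc, h, mul_zero]
  obtain ⟨m', y₂, hy₂, hn₂⟩ := trt_scale S π hπS hπ0 hval f _ h₂'
  have h0 : y₁ * y₂ = 0 := by
    apply trt_map_injective (D := D₂) S.val Subtype.val_injective
    rw [map_mul, hy₁, hy₂, map_zero]
    calc _ = α₁ * (((π ^ (-m)) ⊗ₜ 1 : D₁ ⊗[F] D₂) * ((π ^ m) ⊗ₜ 1)) * α₂ *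
          ((π ^ (-m')) ⊗ₜ 1) := by simp only [mul_assoc]
      _ = 0 := by rw [hcancel, mul_one, h12, zero_mul]
  apply trt_ring hc hinv _ _ hn₁ hn₂
  rw [← map_mul, h0, map_zero]
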